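/- arXiv:2402.04461 — 2 statements merged into one kernel-verified Lean document; each statement's English description precedes it below -/
import Mathlib

section
/- Let Ω₁ and Ω₂ be standard Borel measurable spaces, let p_f be a probability measure on Ω₁ × Ω₂, let p̄ be a probability measure on Ω₁, and let p_c = p̄ ⊗ₘ κ where κ is a disintegration kernel of p_f given the first coordinate. Then KL(p_c ‖ p_f) = KL(p̄ ‖ p_f.map(fst)); i.e., the Kullback–Leibler divergence between the cut posterior and the full posterior equals the divergence between their first-coordinate marginals. -/
open MeasureTheory ProbabilityTheory ENNReal

open Classical in
/-- Kullback–Leibler divergence between two measures, with value `⊤` when `q` is not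
absolutely continuous with respect to `p` (or the log-likelihood ratio is not integrable). -/
noncomputable def KL {Ω : Type*} [MeasurableSpace Ω] (q p : Measure Ω) : ℝ≥0∞ :=
  if q ≪ p ∧ Integrable (llr q p) q then ENNReal.ofReal (∫ x, llr q p x ∂q) else ⊤

open InformationTheory in
theorem KL_eq_klDiv {Ω : Type*} [MeasurableSpace Ω] (q p : Measure Ω)
    [IsProbabilityMeasure q] [IsProbabilityMeasure p] : KL q p = klDiv q p := by
  by_cases h : q ≪ p ∧ Integrable (llr q p) q
  · rw [KL, if_pos h, klDiv_of_ac_of_integrable h.1 h.2]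
    simp
  · rw [KL, if_neg h, eq_comm, ← not_ne_iff, klDiv_ne_top_iff]
    exact h

/-- The KL divergence between the cut posterior and the full posterior equals the KL
divergence between their first-coordinate marginals. -/
theorem KL_cut_eq_KL_marginals
    {Ω₁ Ω₂ : Type*} [MeasurableSpace Ω₁] [MeasurableSpace Ω₂]
    [StandardBorelSpace Ω₁] [StandardBorelSpace Ω₂]
    (p_f : Measure (Ω₁ × Ω₂)) [IsProbabilityMeasure p_f]
    (pbar : Measure Ω₁) [IsProbabilityMeasure pbar]
    (κ : Kernel Ω₁ Ω₂) [IsMarkovKernel κ]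
    (hκ : p_f = (p_f.map Prod.fst) ⊗ₘ κ) :
    KL (pbar ⊗ₘ κ) p_f = KL pbar (p_f.map Prod.fst) := by
  have : IsProbabilityMeasure (p_f.map Prod.fst) :=
    Measure.isProbabilityMeasure_map measurable_fst.aemeasurable
  calc KL (pbar ⊗ₘ κ) p_f
      = KL (pbar ⊗ₘ κ) ((p_f.map Prod.fst) ⊗ₘ κ) := by rw [← hκ]
    _ = KL pbar (p_f.map Prod.fst) := by
      rw [KL_eq_klDiv, KL_eq_klDiv, InformationTheory.klDiv_compProd_left]
end

section
/- Cut posterior in the matrix-variate linear model is matrix-variate normal: let X be a real N×K matrix with XᵀX invertible, W a real L×J matrix with WWᵀ invertible, σ², τ² > 0, and let Y be a fixed real N×J matrix. Let μ be the Gaussian measure on ℝ^{N·L} with mean vec(Y Wᵀ (WWᵀ)⁻¹) and covariance (σ²·(WWᵀ)⁻¹) ⊗ I_N, and for each z ∈ ℝ^{N·L} let κ(z) be the Gaussian measure on ℝ^{K·L} with mean (I_L ⊗ (XᵀX)⁻¹Xᵀ)·z and covariance (τ²·I_L) ⊗ (XᵀX)⁻¹. Then μ.bind(κ) is the Gaussian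 measure on ℝ^{K·L} with mean vec((XᵀX)⁻¹Xᵀ Y Wᵀ(WWᵀ)⁻¹) and covariance (σ²·(WWᵀ)⁻¹ + τ²·I_L) ⊗ (XᵀX)⁻¹. -/
open MeasureTheory ProbabilityTheory Matrix ENNReal
open scoped Kronecker

instance matrixMeasurableSpace {m n : Type*} : MeasurableSpace (Matrix m n ℝ) :=
  (inferInstance : MeasurableSpace (m → n → ℝ))

/-- The Gaussian density `φ(z; m, Σ)` on `ι → ℝ` with mean `m` and covariance matrix `S`
(with respect to Lebesgue measure), under the convention that `S` is positive definite. -/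
noncomputable def gaussDensity {ι : Type*} [Fintype ι] [DecidableEq ι]
    (m : ι → ℝ) (S : Matrix ι ι ℝ) (z : ι → ℝ) : ℝ :=
  (2 * Real.pi) ^ (-(Fintype.card ι : ℝ) / 2) * S.det ^ (-(1 : ℝ) / 2) *
    Real.exp (-(1 / 2) * ((z - m) ⬝ᵥ (S⁻¹ *ᵥ (z - m))))

/-- The Gaussian measure on `ι → ℝ` with mean `m` and (positive definite) covariance `S`,
defined by its density with respect to Lebesgue measure. -/
noncomputable def gaussMeasure {ι : Type*} [Fintype ι] [DecidableEq ι]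
    (m : ι → ℝ) (S : Matrix ι ι ℝ) : Measure (ι → ℝ) :=
  volume.withDensity fun z => ENNReal.ofReal (gaussDensity m S z)

/-- Column-stacking vectorization of an `N × J` matrix: `vecM A (j, i) = A i j`, so that
`vecM (A * B) = (Bᵀ ⊗ₖ 1) *ᵥ vecM A`. -/
def vecM {N J : ℕ} (A : Matrix (Fin N) (Fin J) ℝ) : Fin J × Fin N → ℝ := fun p => A p.2 p.1

section GaussMeasure

open scoped MatrixOrder Matrix.Norms.L2Operator in
theorem Matrix.PosDef.exists_mul_transpose {ι : Type*} [Fintype ι] [DecidableEq ι]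
    {S : Matrix ι ι ℝ} (hS : S.PosDef) : ∃ C : Matrix ι ι ℝ, C.det ≠ 0 ∧ S = C * Cᵀ := by
  obtain ⟨B, hB⟩ := CStarAlgebra.nonneg_iff_eq_star_mul_self.mp hS.posSemidef.nonneg
  have hB' : S = Bᵀ * B := by
    rw [hB, star_eq_conjTranspose, conjTranspose_eq_transpose_of_trivial]
  refine ⟨Bᵀ, fun h => ?_, by rw [hB', transpose_transpose]⟩
  have := hS.det_pos
  rw [hB', det_mul, h, zero_mul] at this
  exact this.false

theorem integral_eq_abs_det_smul_integral_affine {ι E : Type*} [Fintype ι] [DecidableEq ι]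
    [NormedAddCommGroup E] [NormedSpace ℝ E] {C : Matrix ι ι ℝ} (hC : C.det ≠ 0)
    (m : ι → ℝ) (f : (ι → ℝ) → E) :
    ∫ x, f x = |C.det| • ∫ v, f (C *ᵥ v + m) := by
  have hmap := Real.map_matrix_volume_pi_eq_smul_volume_pi hC
  have hemb : MeasurableEmbedding (toLin' C) := by
    have hinj : Function.Injective (toLin' C) :=
      mulVec_injective_iff_isUnit.mpr ((isUnit_iff_isUnit_det C).mpr hC.isUnit)
    exact (LinearMap.continuous_of_finiteDimensional _).measurableEmbedding hinj
  have h := hemb.integral_map (μ := volume) (fun x => f (x + m))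
  rw [hmap, integral_smul_measure, integral_add_right_eq_self f m,
    ENNReal.toReal_ofReal (abs_nonneg _)] at h
  simp only [toLin'_apply] at h
  rw [← h, smul_smul, ← abs_mul, mul_inv_cancel₀ hC, abs_one, one_smul]

theorem measurable_gaussDensity {ι : Type*} [Fintype ι] [DecidableEq ι] (S : Matrix ι ι ℝ) :
    Measurable fun p : (ι → ℝ) × (ι → ℝ) => gaussDensity p.1 S p.2 := by
  have : Continuous fun p : (ι → ℝ) × (ι → ℝ) => gaussDensity p.1 S p.2 := by
    unfold gaussDensity
    fun_prop
  exact this.measurable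

theorem gaussDensity_nonneg {ι : Type*} [Fintype ι] [DecidableEq ι] {S : Matrix ι ι ℝ}
    (hS : S.PosDef) (m z : ι → ℝ) : 0 ≤ gaussDensity m S z := by
  have := hS.det_pos
  unfold gaussDensity
  positivity

theorem gaussDensity_mulVec_add {ι : Type*} [Fintype ι] [DecidableEq ι] {C : Matrix ι ι ℝ}
    (hC : C.det ≠ 0) (m v : ι → ℝ) :
    gaussDensity m (C * Cᵀ) (C *ᵥ v + m) =
      (2 * Real.pi) ^ (-(Fintype.card ι : ℝ) / 2) * |C.det|⁻¹ *
        Real.exp (-(1 / 2) * (v ⬝ᵥ v)) := by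
  have hdet : (C * Cᵀ).det ^ (-(1 : ℝ) / 2) = |C.det|⁻¹ := by
    rw [det_mul, det_transpose, ← sq, neg_div, Real.rpow_neg (sq_nonneg _),
      ← Real.sqrt_eq_rpow, Real.sqrt_sq_eq_abs]
  have hquad : (C *ᵥ v) ⬝ᵥ ((C * Cᵀ)⁻¹ *ᵥ (C *ᵥ v)) = v ⬝ᵥ v := by
    rw [Matrix.mul_inv_rev, mulVec_mulVec, Matrix.mul_assoc, nonsing_inv_mul _ hC.isUnit,
      Matrix.mul_one, ← vecMul_transpose, ← dotProduct_mulVec, mulVec_mulVec,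
      mul_nonsing_inv _ (by simpa using hC.isUnit), one_mulVec]
  rw [gaussDensity, hdet, add_sub_cancel_right, hquad]

theorem gaussDensity_smul_cexp_dotProduct {ι : Type*} [Fintype ι] [DecidableEq ι]
    {C : Matrix ι ι ℝ} (hC : C.det ≠ 0) (m t v : ι → ℝ) :
    gaussDensity m (C * Cᵀ) (C *ᵥ v + m) • Complex.exp ((t ⬝ᵥ (C *ᵥ v + m) : ℝ) * Complex.I) =
      (((2 * Real.pi) ^ (-(Fintype.card ι : ℝ) / 2) * |C.det|⁻¹ : ℝ) : ℂ) *
        Complex.exp ((t ⬝ᵥ m : ℝ) * Complex.I) *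
        Complex.exp (-(1 / 2 : ℂ) * ∑ i, (v i : ℂ) ^ 2 +
          ∑ i, (((Cᵀ *ᵥ t) i : ℂ) * Complex.I) * v i) := by
  have h1 : t ⬝ᵥ (C *ᵥ v + m) = ∑ i, (Cᵀ *ᵥ t) i * v i + t ⬝ᵥ m := by
    rw [dotProduct_add, dotProduct_mulVec, ← mulVec_transpose]; rfl
  have h2 : v ⬝ᵥ v = ∑ i, v i ^ 2 := by simp [dotProduct, sq]
  have h3 : ∑ i, (((Cᵀ *ᵥ t) i : ℂ) * Complex.I) * v i =
      ((∑ i, (Cᵀ *ᵥ t) i * v i : ℝ) : ℂ) * Complex.I := by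
    rw [Complex.ofReal_sum, Finset.sum_mul]
    exact Finset.sum_congr rfl fun i _ => by rw [Complex.ofReal_mul]; ring
  have h4 : ∑ i, (v i : ℂ) ^ 2 = ((∑ i, v i ^ 2 : ℝ) : ℂ) := by
    simp only [Complex.ofReal_sum, Complex.ofReal_pow]
  rw [gaussDensity_mulVec_add hC, h1, h2, h3, h4, Complex.real_smul,
    Complex.ofReal_mul _ (Real.exp _), Complex.ofReal_exp, mul_assoc, mul_assoc, ← Complex.exp_add, ← Complex.exp_add]
  congr 2
  generalize ∑ i, (Cᵀ *ᵥ t) i * v i = a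
  generalize ∑ i, v i ^ 2 = b
  push_cast
  ring

theorem ofReal_two_pi_rpow_mul_cpow (n : ℕ) :
    (((2 * Real.pi) ^ (-(n : ℝ) / 2) : ℝ) : ℂ) * (Real.pi / (1 / 2 : ℂ)) ^ (n / 2 : ℂ) = 1 := by
  have : (Real.pi / (1 / 2 : ℂ)) ^ (n / 2 : ℂ) = (((2 * Real.pi) ^ ((n : ℝ) / 2) : ℝ) : ℂ) := by
    rw [Complex.ofReal_cpow (by positivity)]
    push_cast
    congr 1
    ring
  rw [this, ← Complex.ofReal_mul, ← Real.rpow_add (by positivity)]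
  simp [neg_div]

/-- The characteristic function of the Gaussian measure. -/
theorem integral_cexp_gaussMeasure {ι : Type*} [Fintype ι] [DecidableEq ι]
    (m : ι → ℝ) {S : Matrix ι ι ℝ} (hS : S.PosDef) (t : ι → ℝ) :
    ∫ x, Complex.exp ((t ⬝ᵥ x : ℝ) * Complex.I) ∂gaussMeasure m S =
      Complex.exp ((t ⬝ᵥ m : ℝ) * Complex.I - (t ⬝ᵥ (S *ᵥ t) : ℝ) / 2) := by
  obtain ⟨C, hC, rfl⟩ := hS.exists_mul_transpose
  have hmeas : Measurable (gaussDensity m (C * Cᵀ)) := by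
    have : Continuous (gaussDensity m (C * Cᵀ)) := by
      unfold gaussDensity
      fun_prop
    exact this.measurable
  rw [gaussMeasure, integral_withDensity_eq_integral_toReal_smul hmeas.ennreal_ofReal
    (.of_forall fun _ => ENNReal.ofReal_lt_top)]
  simp_rw [ENNReal.toReal_ofReal (gaussDensity_nonneg hS m _)]
  rw [integral_eq_abs_det_smul_integral_affine hC m]
  simp_rw [gaussDensity_smul_cexp_dotProduct hC]
  rw [integral_const_mul, GaussianFourier.integral_cexp_neg_mul_sum_add (by norm_num),
    Complex.real_smul]
  have hsum : ∑ i, (((Cᵀ *ᵥ t) i : ℂ) * Complex.I) ^ 2 =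
      -((t ⬝ᵥ ((C * Cᵀ) *ᵥ t) : ℝ) : ℂ) := by
    rw [← mulVec_mulVec, dotProduct_mulVec, ← mulVec_transpose]
    simp only [dotProduct, Complex.ofReal_sum, Complex.ofReal_mul, mul_pow, Complex.I_sq,
      ← Finset.sum_neg_distrib]
    exact Finset.sum_congr rfl fun i _ => by ring
  have hdet : ((|C.det| : ℝ) : ℂ) * ((|C.det|⁻¹ : ℝ) : ℂ) = 1 := by
    rw [← Complex.ofReal_mul, mul_inv_cancel₀ (abs_ne_zero.mpr hC), Complex.ofReal_one]
  have hpi := ofReal_two_pi_rpow_mul_cpow (Fintype.card ι)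
  rw [hsum, sub_eq_add_neg, Complex.exp_add, Complex.ofReal_mul]
  generalize t ⬝ᵥ ((C * Cᵀ) *ᵥ t) = q
  rw [show -(q : ℂ) / (4 * (1 / 2)) = -((q : ℂ) / 2) by ring]
  generalize Complex.exp ((t ⬝ᵥ m : ℝ) * Complex.I) = a
  generalize Complex.exp (-((q : ℂ) / 2)) = b
  generalize (((2 * Real.pi) ^ (-(Fintype.card ι : ℝ) / 2) : ℝ) : ℂ) = c at *
  generalize (Real.pi / (1 / 2 : ℂ)) ^ (Fintype.card ι / 2 : ℂ) = d at *
  linear_combination a * b * (c * d * hdet + hpi)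

theorem isProbabilityMeasure_gaussMeasure {ι : Type*} [Fintype ι] [DecidableEq ι]
    (m : ι → ℝ) {S : Matrix ι ι ℝ} (hS : S.PosDef) :
    IsProbabilityMeasure (gaussMeasure m S) := by
  have h := integral_cexp_gaussMeasure m hS 0
  simp only [zero_dotProduct, Complex.ofReal_zero, zero_mul, Complex.exp_zero, zero_div,
    sub_zero, integral_const, Complex.real_smul, mul_one, Complex.ofReal_eq_one] at h
  exact ⟨by rwa [measureReal_def, ENNReal.toReal_eq_one_iff] at h⟩

theorem measurable_gaussMeasure {ι : Type*} [Fintype ι] [DecidableEq ι] (S : Matrix ι ι ℝ) :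
    Measurable fun m : ι → ℝ => gaussMeasure m S := by
  refine Measure.measurable_of_measurable_coe _ fun s hs => ?_
  simp only [gaussMeasure, withDensity_apply _ hs]
  exact (measurable_gaussDensity S).ennreal_ofReal.lintegral_prod_right'

theorem measure_ext_of_integral_cexp_dotProduct {ι : Type*} [Fintype ι]
    {μ ν : Measure (ι → ℝ)} [IsFiniteMeasure μ] [IsFiniteMeasure ν]
    (h : ∀ t : ι → ℝ, ∫ x, Complex.exp ((t ⬝ᵥ x : ℝ) * Complex.I) ∂μ =
      ∫ x, Complex.exp ((t ⬝ᵥ x : ℝ) * Complex.I) ∂ν) : μ = ν := by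
  classical
  refine Measure.ext_of_charFunDual (funext fun f => ?_)
  have hf (x : ι → ℝ) : f x = (fun i => f (Pi.single i 1)) ⬝ᵥ x := by
    conv_lhs => rw [pi_eq_sum_univ' x, map_sum]
    simp_rw [map_smul, smul_eq_mul, dotProduct, mul_comm (x _)]
  simp only [charFunDual_apply]
  convert h (fun i => f (Pi.single i 1)) using 5 <;> exact congrArg _ (hf _)

/-- A linear-Gaussian kernel maps a Gaussian measure to a Gaussian measure. -/
theorem gaussMeasure_bind_gaussMeasure {ι κ : Type*} [Fintype ι] [DecidableEq ι]
    [Fintype κ] [DecidableEq κ] (m : ι → ℝ) {S : Matrix ι ι ℝ} (hS : S.PosDef)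
    (A : Matrix κ ι ℝ) {T : Matrix κ κ ℝ} (hT : T.PosDef) :
    (gaussMeasure m S).bind (fun z => gaussMeasure (A *ᵥ z) T) =
      gaussMeasure (A *ᵥ m) (A * S * Aᵀ + T) := by
  have hV : (A * S * Aᵀ + T).PosDef := by
    have h := hS.posSemidef.mul_mul_conjTranspose_same A
    rw [conjTranspose_eq_transpose_of_trivial] at h
    exact hT.posSemidef_add h
  let η : Kernel (ι → ℝ) (κ → ℝ) :=
    ⟨fun z => gaussMeasure (A *ᵥ z) T,
      (measurable_gaussMeasure T).comp (by fun_prop : Continuous fun z => A *ᵥ z).measurable⟩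
  have hη (z : ι → ℝ) : η z = gaussMeasure (A *ᵥ z) T := rfl
  have : IsMarkovKernel η := ⟨fun z => isProbabilityMeasure_gaussMeasure _ hT⟩
  have := isProbabilityMeasure_gaussMeasure m hS
  have := isProbabilityMeasure_gaussMeasure (A *ᵥ m) hV
  change η ∘ₘ gaussMeasure m S = _
  refine measure_ext_of_integral_cexp_dotProduct fun t => ?_
  have hinteg : Integrable (fun x => Complex.exp ((t ⬝ᵥ x : ℝ) * Complex.I))
      (η ∘ₘ gaussMeasure m S) := by
    refine .of_bound (C := 1) (by fun_prop) (.of_forall fun x => ?_)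
    rw [Complex.norm_exp_ofReal_mul_I]
  rw [integral_cexp_gaussMeasure _ hV, Measure.comp_eq_comp_const_apply,
    Kernel.integral_comp (by rwa [← Measure.comp_eq_comp_const_apply]), Kernel.const_apply]
  simp_rw [hη, integral_cexp_gaussMeasure _ hT, sub_eq_add_neg, Complex.exp_add]
  rw [integral_mul_const]
  simp_rw [dotProduct_mulVec t A, ← mulVec_transpose A]
  rw [integral_cexp_gaussMeasure _ hS, ← Complex.exp_add, ← Complex.exp_add]
  have hquad : t ⬝ᵥ ((A * S * Aᵀ + T) *ᵥ t) =
      (Aᵀ *ᵥ t) ⬝ᵥ (S *ᵥ (Aᵀ *ᵥ t)) + t ⬝ᵥ (T *ᵥ t) := by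
    rw [add_mulVec, dotProduct_add, Matrix.mul_assoc, ← mulVec_mulVec, dotProduct_mulVec t A,
      ← mulVec_transpose A, mulVec_mulVec]
  rw [hquad]
  push_cast
  ring_nf

end GaussMeasure

theorem posDef_mul_transpose_of_isUnit_det {m n : Type*} [Fintype m] [DecidableEq m] [Fintype n]
    {A : Matrix m n ℝ} (h : IsUnit (A * Aᵀ).det) : (A * Aᵀ).PosDef := by
  have hA := posSemidef_self_mul_conjTranspose A
  rw [conjTranspose_eq_transpose_of_trivial] at hA
  exact hA.posDef_iff_det_ne_zero.mpr h.ne_zero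

theorem one_kronecker_mulVec_vecM {N K J : ℕ} (P : Matrix (Fin K) (Fin N) ℝ)
    (A : Matrix (Fin N) (Fin J) ℝ) :
    ((1 : Matrix (Fin J) (Fin J) ℝ) ⊗ₖ P) *ᵥ vecM A = vecM (P * A) := by
  ext ⟨j, k⟩
  simp [mulVec, dotProduct, vecM, Fintype.sum_prod_type, kroneckerMap_apply, one_apply,
    Matrix.mul_apply]

/-- The cut posterior in the matrix-variate linear model is matrix-variate normal:
mixing the second-module conditional posterior `N((I_L ⊗ (XᵀX)⁻¹Xᵀ)z, (τ²·I_L) ⊗ (XᵀX)⁻¹)`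
over the first-level working posterior
`N(vec(Y Wᵀ(WWᵀ)⁻¹), (σ²·(WWᵀ)⁻¹) ⊗ I_N)` yields
`N(vec((XᵀX)⁻¹Xᵀ Y Wᵀ(WWᵀ)⁻¹), (σ²·(WWᵀ)⁻¹ + τ²·I_L) ⊗ (XᵀX)⁻¹)`. -/
theorem cut_posterior_matrix_variate
    {N K L J : ℕ}
    (X : Matrix (Fin N) (Fin K) ℝ) (hX : IsUnit (Xᵀ * X).det)
    (W : Matrix (Fin L) (Fin J) ℝ) (hW : IsUnit (W * Wᵀ).det)
    (σ2 τ2 : ℝ) (hσ : 0 < σ2) (hτ : 0 < τ2)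
    (Y : Matrix (Fin N) (Fin J) ℝ) :
    (gaussMeasure (vecM (Y * Wᵀ * (W * Wᵀ)⁻¹))
        ((σ2 • (W * Wᵀ)⁻¹) ⊗ₖ (1 : Matrix (Fin N) (Fin N) ℝ))).bind
      (fun z => gaussMeasure
        (((1 : Matrix (Fin L) (Fin L) ℝ) ⊗ₖ ((Xᵀ * X)⁻¹ * Xᵀ)) *ᵥ z)
        ((τ2 • (1 : Matrix (Fin L) (Fin L) ℝ)) ⊗ₖ (Xᵀ * X)⁻¹))
      = gaussMeasure (vecM ((Xᵀ * X)⁻¹ * Xᵀ * Y * Wᵀ * (W * Wᵀ)⁻¹))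
          ((σ2 • (W * Wᵀ)⁻¹ + τ2 • (1 : Matrix (Fin L) (Fin L) ℝ)) ⊗ₖ (Xᵀ * X)⁻¹) := by
  have hWW := (posDef_mul_transpose_of_isUnit_det hW).inv
  have hXX : (Xᵀ * X)⁻¹.PosDef := by
    have h := posDef_mul_transpose_of_isUnit_det (A := Xᵀ) (by rwa [transpose_transpose])
    rw [transpose_transpose] at h
    exact h.inv
  have hP : (Xᵀ * X)⁻¹ * Xᵀ * ((Xᵀ * X)⁻¹ * Xᵀ)ᵀ = (Xᵀ * X)⁻¹ := by
    rw [transpose_mul, transpose_transpose, transpose_nonsing_inv, transpose_mul,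
      transpose_transpose, Matrix.mul_assoc, ← Matrix.mul_assoc Xᵀ, mul_nonsing_inv _ hX,
      Matrix.mul_one]
  rw [gaussMeasure_bind_gaussMeasure _ ((hWW.smul hσ).kronecker .one) _
    ((PosDef.one.smul hτ).kronecker hXX), one_kronecker_mulVec_vecM, ← kroneckerMap_transpose,
    ← mul_kronecker_mul, ← mul_kronecker_mul, transpose_one, Matrix.one_mul, Matrix.mul_one,
    Matrix.mul_one, hP, ← add_kronecker]
  simp only [Matrix.mul_assoc]
end
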